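/- arXiv:2309.01200 — 2 statements merged into one kernel-verified Lean document; each statement's English description precedes it below -/
import Mathlib

section
/- (Proposition 2: decomposition of the approximation error.) Let x ∈ X^N be such that Φ_N(x) is invertible. Let (σ_m)_{m≥1} be positive reals and assume the series K(x)_{ij} = Σ_{m≥1} σ_m φ_m(x_i)φ_m(x_j) converges absolutely for all i,j; set K_N^⊥(x)_{ij} = Σ_{m≥N+1} σ_m φ_m(x_i)φ_m(x_j). Let ε = (c_1,…,c_N) ∈ ℝ^N, μ_g(x)_i = Σ_{n=1}^N σ_n c_n φ_n(x_i), and ŵ = Φ_N(x)⁻¹ε. Then: (i) μ_g(x)ᵀ · ŵ = Σ_{n=1}^N σ_n c_n², and (ii) ŵᵀ · K(x) · ŵ = Σ_{n=1}^N σ_n c_n² + εᵀ · (Φ_N(x)⁻¹)ᵀ · K_N^⊥(x) · Φ_N(x)⁻¹ · ε. -/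
open Matrix

/-- The matrix `Φ_N(x)` with entries `Φ_N(x)_{n,i} = φ_n(x_i)`, built from the first `N`
elements (indices `0, …, N-1`) of the family `φ`. -/
def PhiMat {X : Type*} (N : ℕ) (φ : ℕ → X → ℝ) (x : Fin N → X) :
    Matrix (Fin N) (Fin N) ℝ :=
  Matrix.of fun n i => φ n (x i)

/-- The full kernel matrix `K(x)_{ij} = Σ_{m ∈ ℕ} σ_m φ_m(x_i) φ_m(x_j)`. -/
noncomputable def fullKernelMat {X : Type*} (N : ℕ) (φ : ℕ → X → ℝ) (σ : ℕ → ℝ)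
    (x : Fin N → X) : Matrix (Fin N) (Fin N) ℝ :=
  Matrix.of fun i j => ∑' m : ℕ, σ m * φ m (x i) * φ m (x j)

/-- The residual kernel matrix `K_N^⊥(x)_{ij} = Σ_{m ≥ N} σ_m φ_m(x_i) φ_m(x_j)`
(`0`-indexed tail, corresponding to indices `m ≥ N+1` with `1`-indexing). -/
noncomputable def residKernelMat {X : Type*} (N : ℕ) (φ : ℕ → X → ℝ) (σ : ℕ → ℝ)
    (x : Fin N → X) : Matrix (Fin N) (Fin N) ℝ :=
  Matrix.of fun i j => ∑' m : ℕ, σ (N + m) * φ (N + m) (x i) * φ (N + m) (x j)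

/-- Proposition 2: decomposition of the approximation error.
With `ε = c`, `μ_g(x)_i = Σ_n σ_n c_n φ_n(x_i)` and `ŵ = Φ_N(x)⁻¹ ε`:
(i) `μ_g(x)ᵀ ŵ = Σ_n σ_n c_n²` and
(ii) `ŵᵀ K(x) ŵ = Σ_n σ_n c_n² + εᵀ (Φ_N(x)⁻¹)ᵀ K_N^⊥(x) Φ_N(x)⁻¹ ε`. -/
theorem ez_error_decomposition
    {X : Type*} (N : ℕ) (hN : 0 < N) (φ : ℕ → X → ℝ)
    (x : Fin N → X) (hx : IsUnit (PhiMat N φ x).det)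
    (σ : ℕ → ℝ) (hσ : ∀ m, 0 < σ m)
    (hconv : ∀ i j : Fin N, Summable fun m : ℕ => σ m * φ m (x i) * φ m (x j))
    (c : Fin N → ℝ) :
    (fun i => ∑ n : Fin N, σ n * c n * φ n (x i)) ⬝ᵥ ((PhiMat N φ x)⁻¹ *ᵥ c)
        = ∑ n : Fin N, σ n * (c n) ^ 2 ∧
    ((PhiMat N φ x)⁻¹ *ᵥ c) ⬝ᵥ (fullKernelMat N φ σ x *ᵥ ((PhiMat N φ x)⁻¹ *ᵥ c))
        = (∑ n : Fin N, σ n * (c n) ^ 2)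
          + ((PhiMat N φ x)⁻¹ *ᵥ c) ⬝ᵥ
              (residKernelMat N φ σ x *ᵥ ((PhiMat N φ x)⁻¹ *ᵥ c)) := by
  have hw : ∀ n : Fin N, ∑ i, φ n (x i) * ((PhiMat N φ x)⁻¹ *ᵥ c) i = c n := by
    intro n
    have h : PhiMat N φ x *ᵥ ((PhiMat N φ x)⁻¹ *ᵥ c) = c := by
      rw [Matrix.mulVec_mulVec, Matrix.mul_nonsing_inv _ hx, Matrix.one_mulVec]
    exact congrFun h n
  generalize (PhiMat N φ x)⁻¹ *ᵥ c = w at hw ⊢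
  have hi : (fun i => ∑ n : Fin N, σ n * c n * φ n (x i)) ⬝ᵥ w
      = ∑ n : Fin N, σ n * (c n) ^ 2 := by
    simp only [dotProduct, Finset.sum_mul]
    rw [Finset.sum_comm]
    refine Finset.sum_congr rfl fun n _ => ?_
    calc ∑ i, σ n * c n * φ n (x i) * w i = σ n * c n * ∑ i, φ n (x i) * w i := by
          rw [Finset.mul_sum]
          exact Finset.sum_congr rfl fun i _ => by ring
      _ = σ n * (c n) ^ 2 := by rw [hw n]; ring
  refine ⟨hi, ?_⟩
  have hK : fullKernelMat N φ σ x *ᵥ w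
      = (fun i => ∑ n : Fin N, σ n * c n * φ n (x i)) + residKernelMat N φ σ x *ᵥ w := by
    funext i
    have hsplit : ∀ j, fullKernelMat N φ σ x i j
        = (∑ n : Fin N, σ n * φ n (x i) * φ n (x j)) + residKernelMat N φ σ x i j := by
      intro j
      have h := (hconv i j).sum_add_tsum_nat_add N
      rw [← Fin.sum_univ_eq_sum_range (fun m => σ m * φ m (x i) * φ m (x j)) N] at h
      simp only [fullKernelMat, residKernelMat, Matrix.of_apply, ← h, add_comm N]
    simp only [Pi.add_apply, Matrix.mulVec, dotProduct, hsplit, add_mul,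
      Finset.sum_add_distrib, Finset.sum_mul]
    congr 1
    rw [Finset.sum_comm]
    refine Finset.sum_congr rfl fun n _ => ?_
    rw [← hw n, Finset.mul_sum, Finset.sum_mul]
    exact Finset.sum_congr rfl fun j _ => by ring
  rw [hK, dotProduct_add, dotProduct_comm, hi]
end

section
/- (Theorem 3: closed form of the squared RKHS error of the Ermakov–Zolotukhin quadrature.) Let x ∈ X^N be such that Φ_N(x) is invertible. Let (σ_m)_{m≥1} be positive reals such that Σ_{m≥1} σ_m φ_m(x_i)φ_m(x_j) converges absolutely for all i,j; set K_N^⊥(x)_{ij} = Σ_{m≥N+1} σ_m φ_m(x_i)φ_m(x_j). Let ε = (c_1,…,c_N) ∈ ℝ^N and ŵ = Φ_N(x)⁻¹ε. Then Σ_{m≥1} σ_m · ( c_m·1_{m≤N} − Σ_{i=1}^N ŵ_i φ_m(x_i) )² = εᵀ · (Φ_N(x)⁻¹)ᵀ · K_N^⊥(x) · Φ_N(x)⁻¹ · ε, where c_m·1_{m≤N} = c_m for m ≤ N and 0 for m > N. -/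
open Matrix

/-- The coefficients `c_m · 1_{m ≤ N}` of `g = Σ_{n < N} c_n φ_n`: `c_m` for the first `N`
indices and `0` afterwards (`0`-indexed). -/
def extCoeff (N : ℕ) (c : Fin N → ℝ) (m : ℕ) : ℝ :=
  if h : m < N then c ⟨m, h⟩ else 0

/-- Theorem 3: closed form of the squared RKHS error of the
Ermakov–Zolotukhin quadrature.  With `ε = c` and `ŵ = Φ_N(x)⁻¹ ε`,
`Σ_m σ_m (c_m 1_{m≤N} − Σ_i ŵ_i φ_m(x_i))² = εᵀ (Φ_N(x)⁻¹)ᵀ K_N^⊥(x) Φ_N(x)⁻¹ ε`. -/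
theorem ez_squared_error_closed_form
    {X : Type*} (N : ℕ) (hN : 0 < N) (φ : ℕ → X → ℝ)
    (x : Fin N → X) (hx : IsUnit (PhiMat N φ x).det)
    (σ : ℕ → ℝ) (hσ : ∀ m, 0 < σ m)
    (hconv : ∀ i j : Fin N, Summable fun m : ℕ => σ m * φ m (x i) * φ m (x j))
    (c : Fin N → ℝ) :
    ∑' m : ℕ, σ m *
        (extCoeff N c m - ∑ i, ((PhiMat N φ x)⁻¹ *ᵥ c) i * φ m (x i)) ^ 2
      = ((PhiMat N φ x)⁻¹ *ᵥ c) ⬝ᵥ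
          (residKernelMat N φ σ x *ᵥ ((PhiMat N φ x)⁻¹ *ᵥ c)) := by
  set w := (PhiMat N φ x)⁻¹ *ᵥ c with hw
  have hc : PhiMat N φ x *ᵥ w = c := by
    rw [hw, Matrix.mulVec_mulVec, Matrix.mul_nonsing_inv _ hx, Matrix.one_mulVec]
  have hzero : ∀ m, m < N → extCoeff N c m - ∑ i, w i * φ m (x i) = 0 := by
    intro m hm
    have h := congrFun hc ⟨m, hm⟩
    simp only [Matrix.mulVec, dotProduct, PhiMat, Matrix.of_apply] at h
    simp only [extCoeff, hm, dif_pos]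
    rw [← h, sub_eq_zero]
    exact Finset.sum_congr rfl fun i _ => mul_comm _ _
  have hterm : ∀ m : ℕ, σ (m + N) *
      (extCoeff N c (m + N) - ∑ i, w i * φ (m + N) (x i)) ^ 2
      = ∑ i, ∑ j, w i * ((σ (N + m) * φ (N + m) (x i) * φ (N + m) (x j)) * w j) := by
    intro m
    have h0 : extCoeff N c (m + N) = 0 := by simp [extCoeff]
    rw [h0, zero_sub, neg_sq, sq, Finset.sum_mul_sum, Finset.mul_sum, add_comm m N]
    refine Finset.sum_congr rfl fun i _ => ?_
    rw [Finset.mul_sum]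
    exact Finset.sum_congr rfl fun j _ => by ring
  have hs : ∀ i j : Fin N, Summable fun m : ℕ =>
      σ (N + m) * φ (N + m) (x i) * φ (N + m) (x j) := by
    intro i j
    have h := (summable_nat_add_iff N).2 (hconv i j)
    simpa only [add_comm] using h
  have htail : HasSum (fun m : ℕ => σ (m + N) *
      (extCoeff N c (m + N) - ∑ i, w i * φ (m + N) (x i)) ^ 2)
      (w ⬝ᵥ (residKernelMat N φ σ x *ᵥ w)) := by
    simp only [hterm, Matrix.mulVec, dotProduct, residKernelMat, Matrix.of_apply,
      Finset.mul_sum]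
    exact hasSum_sum fun i _ => hasSum_sum fun j _ =>
      (((hs i j).hasSum).mul_right (w j)).mul_left (w i)
  have hfull := (hasSum_nat_add_iff (f := fun m : ℕ => σ m *
      (extCoeff N c m - ∑ i, w i * φ m (x i)) ^ 2) N).1 htail
  rw [Finset.sum_eq_zero, add_zero] at hfull
  · exact hfull.tsum_eq
  · intro m hm
    rw [hzero m (Finset.mem_range.1 hm)]
    simp
end
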